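/- arXiv:2002.05958 — 4 statements merged into one kernel-verified Lean document; each statement's English description precedes it below -/
import Mathlib

section
/- Completeness of PU: for every formula F of conditional logic, if F is valid in the class of all uniform neighbourhood models, then F is derivable in the Hilbert system 𝒜_PU obtained from 𝒜_PCL by adding the axiom schemas (U1) (¬A > ⊥) → ((¬(¬A > ⊥)) > ⊥) and (U2) ¬(A > ⊥) → ((A > ⊥) > ⊥). -/
/-- Formulas of conditional logic. -/
inductive Formula : Type
  | atom : ℕ → Formula
  | bot : Formula
  | and : Formula → Formula → Formula
  | or : Formula → Formula → Formula
  | imp : Formula → Formula → Formula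
  | cond : Formula → Formula → Formula

namespace Formula

/-- ¬A abbreviates A → ⊥. -/
def neg (A : Formula) : Formula := A.imp Formula.bot

/-- ⊤ abbreviates ⊥ → ⊥. -/
def top : Formula := Formula.bot.imp Formula.bot

/-- A ↔ B abbreviates (A → B) ∧ (B → A). -/
def biimp (A B : Formula) : Formula := (A.imp B).and (B.imp A)

/-- Boolean evaluation of a formula, where atoms are evaluated via `v` and
conditional subformulas are treated as atoms evaluated via `w`. -/
def beval (v : ℕ → Bool) (w : Formula → Formula → Bool) : Formula → Bool
  | atom p => v p
  | bot => false
  | and A B => beval v w A && beval v w B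
  | or A B => beval v w A || beval v w B
  | imp A B => !(beval v w A) || beval v w B
  | cond A B => w A B

/-- Classical propositional tautology (conditional subformulas treated as atoms). -/
def Tautology (F : Formula) : Prop := ∀ v w, beval v w F = true

end Formula

open Formula

/-- Hilbert-style derivability: classical tautologies, modus ponens,
(RCEA), (RCK), (ID), (R-And), (CM), (OR), plus extra axioms from `Ax`. -/
inductive Deriv (Ax : Set Formula) : Formula → Prop
  | taut {F : Formula} : Tautology F → Deriv Ax F
  | extra {F : Formula} : F ∈ Ax → Deriv Ax F
  | mp {A B : Formula} : Deriv Ax (A.imp B) → Deriv Ax A → Deriv Ax B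
  | rcea {A B C : Formula} : Deriv Ax (A.biimp B) →
      Deriv Ax ((A.cond C).biimp (B.cond C))
  | rck {A B C : Formula} : Deriv Ax (A.imp B) → Deriv Ax ((C.cond A).imp (C.cond B))
  | id {A : Formula} : Deriv Ax (A.cond A)
  | rAnd {A B C : Formula} : Deriv Ax (((A.cond B).and (A.cond C)).imp (A.cond (B.and C)))
  | cm {A B C : Formula} : Deriv Ax (((A.cond B).and (A.cond C)).imp ((A.and B).cond C))
  | or {A B C : Formula} : Deriv Ax (((A.cond C).and (B.cond C)).imp ((A.or B).cond C))

/-- Derivability in the basic preferential conditional logic PCL. -/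
def PCL : Formula → Prop := Deriv ∅

/-- Forcing of a formula at a world, for raw neighbourhood data. -/
def Force {W : Type} (N : W → Set (Set W)) (val : ℕ → Set W) : Formula → W → Prop
  | Formula.atom p, x => x ∈ val p
  | Formula.bot, _ => False
  | Formula.and A B, x => Force N val A x ∧ Force N val B x
  | Formula.or A B, x => Force N val A x ∨ Force N val B x
  | Formula.imp A B, x => Force N val A x → Force N val B x
  | Formula.cond A B, x => ∀ α ∈ N x, (∃ y ∈ α, Force N val A y) →
      ∃ β ∈ N x, β ⊆ α ∧ (∃ y ∈ β, Force N val A y) ∧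
        ∀ y ∈ β, (Force N val A y → Force N val B y)

/-- A neighbourhood model. -/
structure NbhdModel where
  W : Type
  wNonempty : Nonempty W
  N : W → Set (Set W)
  val : ℕ → Set W
  nbhdNonempty : ∀ x : W, ∀ α ∈ N x, α.Nonempty

/-- Forcing in a neighbourhood model. -/
def NbhdModel.force (M : NbhdModel) : Formula → M.W → Prop := Force M.N M.val

/-- Validity in the class of all neighbourhood models. -/
def ValidAll (F : Formula) : Prop := ∀ (M : NbhdModel) (x : M.W), M.force F x

/-- Total reflexivity. -/
def NbhdModel.TotallyReflexive (M : NbhdModel) : Prop :=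
  ∀ x : M.W, ∃ α ∈ M.N x, x ∈ α

/-- Weak centering. -/
def NbhdModel.WeaklyCentered (M : NbhdModel) : Prop :=
  ∀ x : M.W, ∀ α ∈ M.N x, x ∈ α

/-- Centering. -/
def NbhdModel.Centered (M : NbhdModel) : Prop :=
  (∀ x : M.W, ∀ α ∈ M.N x, x ∈ α) ∧ ∀ x : M.W, {x} ∈ M.N x

/-- Uniformity. -/
def NbhdModel.Uniform (M : NbhdModel) : Prop :=
  ∀ x y : M.W, (∃ α ∈ M.N x, y ∈ α) → ⋃₀ M.N x = ⋃₀ M.N y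

/-- Absoluteness. -/
def NbhdModel.Absolute (M : NbhdModel) : Prop :=
  ∀ x y : M.W, ∀ α ∈ M.N x, y ∈ α → M.N x = M.N y

/-- Conjunction of a list of formulas. -/
def conj : List Formula → Formula
  | [] => Formula.top
  | A :: l => A.and (conj l)

/-- A set of formulas is inconsistent if some nonempty finite list of its members
has a PCL-provably contradictory conjunction. -/
def Inconsistent (S : Set Formula) : Prop :=
  ∃ L : List Formula, L ≠ [] ∧ (∀ B ∈ L, B ∈ S) ∧ PCL ((conj L).imp Formula.bot)

def Consistent (S : Set Formula) : Prop := ¬ Inconsistent S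

/-- Maximal consistent set. -/
def MaxConsistent (S : Set Formula) : Prop :=
  Consistent S ∧ ∀ A ∉ S, Inconsistent (insert A S)

/-- Set of conditional consequences X^B = {C : B > C ∈ X}. -/
def condCons (X : Set Formula) (B : Formula) : Set Formula := {C | B.cond C ∈ X}

/-- A ≤_X B iff (A ∨ B) > A ∈ X. -/
def cleq (X : Set Formula) (A B : Formula) : Prop := (A.or B).cond A ∈ X

/-- Worlds of the canonical model: pairs (X, A) with X maximal consistent, A ∈ X. -/
def CanonWorld : Type :=
  {p : Set Formula × Formula // MaxConsistent p.1 ∧ p.2 ∈ p.1}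

/-- Canonical neighbourhood α^X_{(Y,B)}. -/
def sphere (X : Set Formula) (Y : CanonWorld) : Set CanonWorld :=
  {Z | condCons X Z.val.2 ⊆ Z.val.1 ∧ cleq X Z.val.2 Y.val.2 ∧ Y.val.2 ∉ Z.val.1}
    ∪ {Y}

/-- Canonical neighbourhood function 𝒩(X,A). -/
def canonN (x : CanonWorld) : Set (Set CanonWorld) :=
  {α | ∃ Y : CanonWorld, condCons x.val.1 Y.val.2 ⊆ Y.val.1 ∧ α = sphere x.val.1 Y}

/-- Canonical valuation. -/
def canonVal (p : ℕ) : Set CanonWorld := {w | Formula.atom p ∈ w.val.1}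

/-- Axiom (N). -/
def axN : Formula := (Formula.top.cond Formula.bot).neg
/-- Axiom schema (T). -/
def axT : Set Formula := {F | ∃ A : Formula, F = A.imp (A.cond Formula.bot).neg}
/-- Axiom schema (W). -/
def axW : Set Formula := {F | ∃ A B : Formula, F = (A.cond B).imp (A.imp B)}
/-- Axiom schema (C). -/
def axC : Set Formula := {F | ∃ A B : Formula, F = (A.and B).imp (A.cond B)}
/-- Axiom schema (U1). -/
def axU1 : Set Formula :=
  {F | ∃ A : Formula,
    F = (A.neg.cond Formula.bot).imp ((A.neg.cond Formula.bot).neg.cond Formula.bot)}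
/-- Axiom schema (U2). -/
def axU2 : Set Formula :=
  {F | ∃ A : Formula,
    F = (A.cond Formula.bot).neg.imp ((A.cond Formula.bot).cond Formula.bot)}

/-- The logic PU. -/
def PU : Formula → Prop := Deriv (axU1 ∪ axU2)

structure Th (T : Set Formula) : Prop where
  thm : ∀ F, PU F → F ∈ T
  mp : ∀ A B, A.imp B ∈ T → A ∈ T → B ∈ T

structure MCS (T : Set Formula) : Prop extends Th T where
  cons : Formula.bot ∉ T
  compl : ∀ A, A ∈ T ∨ A.neg ∈ T

theorem Th.t1 {T : Set Formula} (h : Th T) {A B : Formula} (ht : Tautology (A.imp B))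
    (hA : A ∈ T) : B ∈ T := h.mp _ _ (h.thm _ (Deriv.taut ht)) hA

theorem Th.t2 {T : Set Formula} (h : Th T) {A B C : Formula}
    (ht : Tautology (A.imp (B.imp C))) (hA : A ∈ T) (hB : B ∈ T) : C ∈ T :=
  h.mp _ _ (h.t1 ht hA) hB

theorem lindenbaum {S : Set Formula} (hS : Th S) {B : Formula} (hB : B ∉ S) :
    ∃ X, MCS X ∧ S ⊆ X ∧ B ∉ X := by
  obtain ⟨X, hSX, hX⟩ := zorn_subset_nonempty {T | Th T ∧ B ∉ T} (by
    intro c hc hch hne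
    refine ⟨⋃₀ c, ⟨⟨?_, ?_⟩, ?_⟩, fun s hs => Set.subset_sUnion_of_mem hs⟩
    · intro F hF
      obtain ⟨s, hs⟩ := hne
      exact ⟨s, hs, (hc hs).1.thm F hF⟩
    · rintro A C ⟨s, hs, h1⟩ ⟨t, ht, h2⟩
      rcases hch.total hs ht with h | h
      · exact ⟨t, ht, (hc ht).1.mp _ _ (h h1) h2⟩
      · exact ⟨s, hs, (hc hs).1.mp _ _ h1 (h h2)⟩
    · rintro ⟨s, hs, h1⟩
      exact (hc hs).2 h1) S ⟨hS, hB⟩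
  have hT := hX.prop.1
  have hBX := hX.prop.2
  have key : ∀ A, A ∉ X → A.imp B ∈ X := by
    intro A hA
    by_contra hAB
    have hth : Th {C | A.imp C ∈ X} := by
      refine ⟨fun F hF => ?_, fun C D h1 h2 => ?_⟩
      · refine hT.t1 ?_ (hT.thm F hF)
        intro v w; simp [beval]; grind
      · refine hT.t2 ?_ h1 h2
        intro v w; simp [beval]; grind
    have hsub : X ⊆ {C | A.imp C ∈ X} := by
      intro C hC
      refine hT.t1 ?_ hC
      intro v w; simp [beval]; grind
    have := hX.le_of_ge (y := {C | A.imp C ∈ X}) ⟨hth, hAB⟩ hsub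
    apply hA
    apply this
    refine hT.thm _ (Deriv.taut ?_)
    intro v w; simp [beval]
  refine ⟨X, ⟨hT, ?_, ?_⟩, hSX, hBX⟩
  · intro hb
    apply hBX
    refine hT.t1 ?_ hb
    intro v w; simp [beval]
  · intro A
    by_contra! hcon
    apply hBX
    refine hT.t2 ?_ (key _ hcon.1) (key _ hcon.2)
    intro v w; simp [beval, neg]; grind

section theory
variable {X : Set Formula}

theorem Th.rck (h : Th X) {A B C : Formula} (ht : PU (B.imp C)) (hB : A.cond B ∈ X) :
    A.cond C ∈ X := h.mp _ _ (h.thm _ (Deriv.rck ht)) hB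

theorem Th.cid (h : Th X) (A : Formula) : A.cond A ∈ X := h.thm _ Deriv.id

theorem Th.cand (h : Th X) {A B C : Formula} (h1 : A.cond B ∈ X) (h2 : A.cond C ∈ X) :
    A.cond (B.and C) ∈ X := by
  refine h.mp _ _ (h.thm _ Deriv.rAnd) (h.t2 ?_ h1 h2)
  intro v w; simp [beval]; grind

theorem Th.cK (h : Th X) {A B C D : Formula} (ht : Tautology ((B.and C).imp D))
    (h1 : A.cond B ∈ X) (h2 : A.cond C ∈ X) : A.cond D ∈ X :=
  h.rck (Deriv.taut ht) (h.cand h1 h2)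

theorem Th.cea (h : Th X) {A B C : Formula} (ht : Tautology (A.biimp B))
    (h1 : A.cond C ∈ X) : B.cond C ∈ X := by
  refine h.t2 ?_ (h.thm _ (Deriv.rcea (C := C) (Deriv.taut ht))) h1
  intro v w; simp [beval, biimp]; grind

theorem Th.lift (h : Th X) {A B G : Formula} (ht : Tautology (A.imp G))
    (h1 : A.cond B ∈ X) : G.cond (A.imp B) ∈ X := by
  have h2 : A.cond (A.imp B) ∈ X := by
    refine h.rck (Deriv.taut ?_) h1
    intro v w; simp [beval]; grind
  have h3 : (G.and A.neg).cond (A.imp B) ∈ X := by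
    refine h.rck (Deriv.taut ?_) (h.cid _)
    intro v w; simp [beval, neg]; grind
  have h4 : (A.or (G.and A.neg)).cond (A.imp B) ∈ X := by
    refine h.mp _ _ (h.thm _ Deriv.or) (h.t2 ?_ h2 h3)
    intro v w; simp [beval]; grind
  refine h.cea ?_ h4
  intro v w
  have := ht v w
  simp [beval, neg, biimp] at this ⊢; grind

theorem Th.cmE (h : Th X) {G E K : Formula} (ht : Tautology (E.imp G))
    (h1 : G.cond E ∈ X) (h2 : G.cond K ∈ X) : E.cond K ∈ X := by
  have h4 : (G.and E).cond K ∈ X := by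
    refine h.mp _ _ (h.thm _ Deriv.cm) (h.t2 ?_ h1 h2)
    intro v w; simp [beval]; grind
  refine h.cea ?_ h4
  intro v w
  have := ht v w
  simp [beval, biimp] at this ⊢; grind

theorem Th.condTh (h : Th X) (A : Formula) : Th (condCons X A) := by
  refine ⟨fun F hF => ?_, fun B C h1 h2 => ?_⟩
  · refine h.rck ?_ (h.cid A)
    refine Deriv.mp (Deriv.taut ?_) hF
    intro v w; simp [beval]; grind
  · refine h.cK ?_ h1 h2
    intro v w; simp [beval]; grind

/-- three-way order lemma -/
theorem Th.tri (h : Th X) {E D A : Formula} (h1 : cleq X E D) (h2 : cleq X D A) :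
    (E.or (D.or A)).cond E ∈ X := by
  have a1 : (E.or (D.or A)).cond ((E.or D).imp E) ∈ X := by
    refine h.lift ?_ h1
    intro v w; simp [beval]; grind
  have a2 : (E.or (D.or A)).cond ((D.or A).imp D) ∈ X := by
    refine h.lift ?_ h2
    intro v w; simp [beval]; grind
  refine h.cK ?_ (h.cand a1 a2) (h.cid _)
  intro v w; simp [beval]; grind

theorem Th.trans (h : Th X) {E D A : Formula} (h1 : cleq X E D) (h2 : cleq X D A) :
    cleq X E A := by
  have h3 := h.tri h1 h2
  refine h.cmE (G := E.or (D.or A)) ?_ ?_ h3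
  · intro v w; simp [beval]; grind
  · refine h.rck (Deriv.taut ?_) h3
    intro v w; simp [beval]; grind

/-- If E ≤ D ≤ A, V is normal for E and A ∈ V then V is normal for D. -/
theorem Th.normal (h : Th X) {E D A : Formula} {V : Set Formula} (hV : Th V)
    (h1 : cleq X E D) (h2 : cleq X D A) (hn : condCons X E ⊆ V) (hA : A ∈ V) :
    condCons X D ⊆ V := by
  intro K hK
  have b1 : (D.or A).cond (D.imp K) ∈ X := by
    refine h.lift ?_ hK
    intro v w; simp [beval]; grind
  have b2 : (D.or A).cond K ∈ X := by
    refine h.cK ?_ b1 h2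
    intro v w; simp [beval]; grind
  have b3 : (E.or (D.or A)).cond ((D.or A).imp K) ∈ X := by
    refine h.lift ?_ b2
    intro v w; simp [beval]; grind
  have b4 : E.cond ((D.or A).imp K) ∈ X := by
    refine h.cmE ?_ (h.tri h1 h2) b3
    intro v w; simp [beval]; grind
  refine hV.t2 ?_ (hn b4) hA
  intro v w; simp [beval]; grind

end theory

/-- Worlds. -/
def PW : Type := {p : Set Formula × Formula // MCS p.1 ∧ p.2 ∈ p.1}

def bigU (X : Set Formula) : Set PW :=
  {Z | ∀ A : Formula, A.neg.cond Formula.bot ∈ X → A ∈ Z.val.1}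

def sph (X : Set Formula) (Y : PW) : Set PW :=
  {Z | condCons X Z.val.2 ⊆ Z.val.1 ∧ cleq X Z.val.2 Y.val.2 ∧ Y.val.2 ∉ Z.val.1} ∪ {Y}

def pN (x : PW) : Set (Set PW) :=
  {α | (∃ Y : PW, condCons x.val.1 Y.val.2 ⊆ Y.val.1 ∧ α = sph x.val.1 Y) ∨
    (α = bigU x.val.1 ∧ α.Nonempty)}

def pVal (p : ℕ) : Set PW := {w | Formula.atom p ∈ w.val.1}

theorem normal_bigU {X : Set Formula} (h : Th X) (Z : PW)
    (hZ : condCons X Z.val.2 ⊆ Z.val.1) : Z ∈ bigU X := by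
  intro D hD
  apply hZ
  have c1 : (Z.val.2.or D.neg).cond (D.neg.imp Formula.bot) ∈ X := by
    refine h.lift ?_ hD
    intro v w; simp [beval]; grind
  have c2 : (Z.val.2.or D.neg).cond Z.val.2 ∈ X := by
    refine h.cK ?_ c1 (h.cid _)
    intro v w; simp [beval, neg]; grind
  refine h.rck (Deriv.taut ?_) (h.cmE (G := Z.val.2.or D.neg) ?_ c2 c1)
  · intro v w; simp [beval, neg]
  · intro v w; simp [beval]; grind

theorem sph_bigU {X : Set Formula} (h : Th X) (Y : PW)
    (hY : condCons X Y.val.2 ⊆ Y.val.1) : sph X Y ⊆ bigU X := by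
  rintro Z (hZ | rfl)
  · exact normal_bigU h Z hZ.1
  · exact normal_bigU h Z hY

theorem sUnion_pN (x : PW) : ⋃₀ pN x = bigU x.val.1 := by
  apply Set.Subset.antisymm
  · rintro z ⟨α, (⟨Y, hY, rfl⟩ | ⟨rfl, -⟩), hz⟩
    · exact sph_bigU x.2.1.toTh Y hY hz
    · exact hz
  · intro z hz
    exact ⟨bigU x.val.1, Or.inr ⟨rfl, ⟨z, hz⟩⟩, hz⟩

theorem MCS.neg_iff {X : Set Formula} (h : MCS X) (A : Formula) : A.neg ∈ X ↔ A ∉ X := by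
  constructor
  · intro h1 h2
    exact h.cons (h.mp _ _ h1 h2)
  · intro h1
    exact (h.compl A).resolve_left h1

theorem bigU_eq (x y : PW) (hy : y ∈ bigU x.val.1) : bigU x.val.1 = bigU y.val.1 := by
  have key : ∀ A : Formula, A.neg.cond Formula.bot ∈ x.val.1 ↔
      A.neg.cond Formula.bot ∈ y.val.1 := by
    intro A
    constructor
    · intro h
      apply hy
      exact x.2.1.mp _ _ (x.2.1.thm _ (Deriv.extra (Or.inl ⟨A, rfl⟩))) h
    · intro h
      by_contra hn
      have h2 := (x.2.1.neg_iff _).2 hn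
      have h3 := x.2.1.mp _ _ (x.2.1.thm _ (Deriv.extra (Or.inr ⟨A.neg, rfl⟩))) h2
      have h4 := hy (A.neg.cond Formula.bot).neg (x.2.1.cea (by
        intro v w; simp [beval, biimp, neg]) h3)
      exact (y.2.1.neg_iff _).1 h4 h
  ext z
  simp only [bigU, Set.mem_ofPred_eq, key]

theorem truth (A : Formula) : ∀ x : PW, Force pN pVal A x ↔ A ∈ x.val.1 := by
  induction A with
  | atom p => intro x; rfl
  | bot => intro x; simpa [Force] using x.2.1.cons
  | and A B ihA ihB =>
    intro x
    simp only [Force, ihA, ihB]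
    constructor
    · rintro ⟨h1, h2⟩
      refine x.2.1.t2 ?_ h1 h2
      intro v w; simp [beval]; grind
    · intro h
      constructor <;> refine x.2.1.t1 ?_ h <;> intro v w <;> simp [beval] <;> grind
  | or A B ihA ihB =>
    intro x
    simp only [Force, ihA, ihB]
    constructor
    · rintro (h | h) <;> refine x.2.1.t1 ?_ h <;> intro v w <;> simp [beval] <;> grind
    · intro h
      by_contra! hc
      refine x.2.1.cons (x.2.1.mp _ _ (x.2.1.t2 ?_ ((x.2.1.neg_iff _).2 hc.1)
        ((x.2.1.neg_iff _).2 hc.2)) h)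
      intro v w; simp [beval, neg]; grind
  | imp A B ihA ihB =>
    intro x
    simp only [Force, ihA, ihB]
    constructor
    · intro h
      by_cases hA : A ∈ x.val.1
      · refine x.2.1.t1 ?_ (h hA)
        intro v w; simp [beval]; grind
      · refine x.2.1.t1 ?_ ((x.2.1.neg_iff _).2 hA)
        intro v w; simp [beval, neg]; grind
    · intro h hA
      exact x.2.1.mp _ _ h hA
  | cond A B ihA ihB =>
    intro x
    simp only [Force, ihA, ihB]
    have hX := x.2.1.toTh
    constructor
    · intro h
      by_contra hn
      obtain ⟨Z, hZ, hsub, hB⟩ := lindenbaum (hX.condTh A) (B := B) hn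
      have hAZ : A ∈ Z := hsub (hX.cid A)
      let z : PW := ⟨(Z, A), hZ, hAZ⟩
      obtain ⟨β, -, hβ, ⟨y, hy, hyA⟩, hall⟩ := h (sph x.val.1 z) (Or.inl ⟨z, hsub, rfl⟩)
        ⟨z, Or.inr rfl, hAZ⟩
      rcases hβ hy with h1 | h1
      · exact h1.2.2 hyA
      · have hyz : y = z := h1
        subst hyz
        exact hB (hall _ hy hyA)
    · rintro hAB α (⟨Y, hY, rfl⟩ | ⟨rfl, -⟩) ⟨z, hz, hzA⟩
      · have hzn : condCons x.val.1 z.val.2 ⊆ z.val.1 := by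
          rcases hz with h1 | h1
          · exact h1.1
          · have : z = Y := h1
            rw [this]; exact hY
        -- spheres below a point of the sphere
        have hmono : ∀ u : PW, condCons x.val.1 u.val.2 ⊆ u.val.1 →
            u ∈ sph x.val.1 z → sph x.val.1 u ⊆ sph x.val.1 z := by
          intro u hu huz w hw
          rcases hw with hw | hw
          · rcases huz with huz | huz
            · refine Or.inl ⟨hw.1, hX.trans hw.2.1 huz.2.1, fun hzw => ?_⟩
              exact hw.2.2 (hX.normal w.2.1.toTh hw.2.1 huz.2.1 hw.1 hzw (hX.cid _))
            · have : u = z := huz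
              subst this
              exact Or.inl hw
          · have : w = u := hw
            subst this
            exact huz
        have hzY : sph x.val.1 z ⊆ sph x.val.1 Y := by
          intro w hw
          rcases hz with hz | hz
          · rcases hw with hw | hw
            · refine Or.inl ⟨hw.1, hX.trans hw.2.1 hz.2.1, fun hzw => ?_⟩
              exact hw.2.2 (hX.normal w.2.1.toTh hw.2.1 hz.2.1 hw.1 hzw (hX.cid _))
            · have : w = z := hw
              subst this
              exact Or.inl hz
          · have : z = Y := hz
            subst this
            exact hw
        have hlift : (A.or z.val.2).cond (A.imp B) ∈ x.val.1 := by
          refine hX.lift ?_ hAB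
          intro v w; simp [beval]; grind
        by_cases hD : (A.or z.val.2).cond z.val.2 ∈ x.val.1
        · refine ⟨sph x.val.1 z, Or.inl ⟨z, hzn, rfl⟩, hzY, ⟨z, Or.inr rfl, hzA⟩, ?_⟩
          intro y hy hyA
          have hle : cleq x.val.1 z.val.2 A := by
            refine hX.cea ?_ hD
            intro v w; simp [beval, biimp]; grind
          rcases hy with hy | hy
          · exact absurd (hX.normal y.2.1.toTh hy.2.1 hle hy.1 hyA (hX.cid _)) hy.2.2
          · have : y = z := hy
            subst this
            refine y.2.1.mp _ _ (hzn (hX.cmE ?_ hD hlift)) hyA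
            intro v w; simp [beval]; grind
        · obtain ⟨V, hV, hsub, hDV⟩ := lindenbaum (hX.condTh (A.or z.val.2)) hD
          have hor : A.or z.val.2 ∈ V := hsub (hX.cid _)
          have hAV : A ∈ V := by
            refine hV.t2 ?_ hor ((hV.neg_iff _).2 hDV)
            intro v w; simp [beval, neg]; grind
          let u : PW := ⟨(V, A.or z.val.2), hV, hor⟩
          refine ⟨sph x.val.1 u, Or.inl ⟨u, hsub, rfl⟩, (hmono u hsub ?_).trans hzY,
            ⟨u, Or.inr rfl, hAV⟩, ?_⟩
          · refine Or.inl ⟨hsub, ?_, hDV⟩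
            refine hX.cea ?_ (hX.rck (Deriv.taut ?_) (hX.cid (A.or z.val.2)))
            · intro v w; simp [u, beval, biimp]; grind
            · intro v w; simp [u, beval]; grind
          · intro y hy hyA
            rcases hy with hy | hy
            · refine absurd (y.2.1.t1 ?_ hyA) hy.2.2
              intro v w; simp [u, beval]; grind
            · have : y = u := hy
              subst this
              exact hV.mp _ _ (hsub hlift) hAV
      · have hbot : A.cond Formula.bot ∉ x.val.1 := by
          intro hb
          have := hz A.neg (hX.cea (by intro v w; simp [beval, biimp, neg]) hb)
          exact (z.2.1.neg_iff _).1 this hzA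
        obtain ⟨V, hV, hsub, -⟩ := lindenbaum (hX.condTh A) hbot
        have hAV : A ∈ V := hsub (hX.cid A)
        let u : PW := ⟨(V, A), hV, hAV⟩
        refine ⟨sph x.val.1 u, Or.inl ⟨u, hsub, rfl⟩, sph_bigU hX u hsub,
          ⟨u, Or.inr rfl, hAV⟩, ?_⟩
        intro y hy hyA
        rcases hy with hy | hy
        · exact absurd hyA hy.2.2
        · have : y = u := hy
          subst this
          exact hsub hAB

/-- Completeness of PU w.r.t. uniform neighbourhood models. -/
theorem pu_completeness (F : Formula)
    (h : ∀ M : NbhdModel, M.Uniform → ∀ x : M.W, M.force F x) :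
    Deriv (axU1 ∪ axU2) F := by
  by_contra hF
  have hth : Th {G | PU G} := ⟨fun _ h => h, fun _ _ h1 h2 => Deriv.mp h1 h2⟩
  obtain ⟨X, hX, -, hFX⟩ := lindenbaum hth (B := F) hF
  let x : PW := ⟨(X, Formula.top), hX, hX.thm _ (Deriv.taut (by
    intro v w; simp [Formula.top, beval]))⟩
  let M : NbhdModel :=
    { W := PW
      wNonempty := ⟨x⟩
      N := pN
      val := pVal
      nbhdNonempty := by
        rintro y α (⟨Y, -, rfl⟩ | ⟨-, h⟩)
        · exact ⟨Y, Or.inr rfl⟩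
        · exact h }
  refine hFX ((truth F x).1 (h M ?_ x))
  rintro y z ⟨α, hα, hz⟩
  have hz' : z ∈ ⋃₀ pN y := ⟨α, hα, hz⟩
  rw [sUnion_pN] at hz'
  change ⋃₀ pN y = ⋃₀ pN z
  rw [sUnion_pN, sUnion_pN]
  exact bigU_eq y z hz'
end

section
/- Completeness of PC: for every formula F of conditional logic, if F is valid in the class of all centered neighbourhood models, then F is derivable in the Hilbert system 𝒜_PC obtained from 𝒜_PCL by adding the axiom schemas (N) ¬(⊤ > ⊥), (T) A → ¬(A > ⊥), (W) (A>B) → (A→B), and (C) (A ∧ B) → (A > B). -/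
open Formula

namespace PCProof

abbrev PAx : Set Formula := insert axN (axT ∪ axW ∪ axC)

/-- Deductively closed sets of formulas. -/
structure Th (T : Set Formula) : Prop where
  thm : ∀ {A : Formula}, Deriv PAx A → A ∈ T
  mp : ∀ {A B : Formula}, A.imp B ∈ T → A ∈ T → B ∈ T

/-- Maximal consistent theories. -/
structure MT (T : Set Formula) : Prop extends Th T where
  nbot : Formula.bot ∉ T
  total : ∀ A : Formula, A ∈ T ∨ A.neg ∈ T

theorem Th.t1 {T : Set Formula} (h : Th T) {A B : Formula} (t : Tautology (A.imp B))
    (a : A ∈ T) : B ∈ T := h.mp (h.thm (.taut t)) a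

theorem Th.t2 {T : Set Formula} (h : Th T) {A B C : Formula} (t : Tautology (A.imp (B.imp C)))
    (a : A ∈ T) (b : B ∈ T) : C ∈ T := h.mp (h.t1 t a) b

theorem Th.t3 {T : Set Formula} (h : Th T) {A B C D : Formula}
    (t : Tautology (A.imp (B.imp (C.imp D))))
    (a : A ∈ T) (b : B ∈ T) (c : C ∈ T) : D ∈ T := h.mp (h.t2 t a b) c

theorem taut_of {F : Formula} (h : ∀ v w, beval v w F = true) : Tautology F := h

theorem lindenbaum {T : Set Formula} (hT : Th T) {A : Formula} (hA : A ∉ T) :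
    ∃ Y, MT Y ∧ T ⊆ Y ∧ A ∉ Y := by
  obtain ⟨Y, hTY, hY⟩ := zorn_subset_nonempty {Y : Set Formula | Th Y ∧ A ∉ Y} (by
    intro c hc hch hne
    refine ⟨⋃₀ c, ⟨⟨?_, ?_⟩, ?_⟩, fun s hs => Set.subset_sUnion_of_mem hs⟩
    · intro B hB
      obtain ⟨s, hs⟩ := hne
      exact ⟨s, hs, (hc hs).1.thm hB⟩
    · rintro B C ⟨s, hs, hB⟩ ⟨t, ht, hC⟩
      rcases hch.total hs ht with h | h
      · exact ⟨t, ht, (hc ht).1.mp (h hB) hC⟩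
      · exact ⟨s, hs, (hc hs).1.mp hB (h hC)⟩
    · rintro ⟨s, hs, hA'⟩
      exact (hc hs).2 hA') T ⟨hT, hA⟩
  obtain ⟨⟨hYT, hAY⟩, hmax⟩ := hY
  have key : ∀ B : Formula, B ∉ Y → B.imp A ∈ Y := by
    intro B hB
    by_contra hBA
    have hsub : Y ⊆ {C | B.imp C ∈ Y} := fun C hC => hYT.t1 (by
      intro v w; simp only [beval]
      cases beval v w B <;> cases beval v w C <;> rfl) hC
    have : {C | B.imp C ∈ Y} ⊆ Y := hmax ⟨⟨fun {C} hC => hsub (hYT.thm hC), fun {C D} h1 h2 =>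
      hYT.t2 (by
        intro v w; simp only [beval]
        cases beval v w B <;> cases beval v w C <;> cases beval v w D <;> rfl) h1 h2⟩, hBA⟩ hsub
    exact hB (this (hYT.thm (.taut (by
      intro v w; simp only [beval]; cases beval v w B <;> rfl))))
  refine ⟨Y, ⟨hYT, ?_, ?_⟩, hTY, hAY⟩
  · intro hb
    exact hAY (hYT.t1 (by intro v w; simp [beval]) hb)
  · intro B
    by_contra hB
    push Not at hB
    exact hAY (hYT.t2 (by
      intro v w; simp only [beval, neg]
      cases beval v w A <;> cases beval v w B <;> rfl) (key _ hB.1) (key _ hB.2))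

namespace MT
variable {X : Set Formula}

theorem imp_iff (h : MT X) {A B : Formula} : A.imp B ∈ X ↔ (A ∈ X → B ∈ X) := by
  refine ⟨fun h1 h2 => h.mp h1 h2, fun h1 => ?_⟩
  rcases h.total A with ha | ha
  · exact h.t1 (by
      intro v w; simp only [beval]
      cases beval v w A <;> cases beval v w B <;> rfl) (h1 ha)
  · exact h.t1 (by
      intro v w; simp only [beval, neg]
      cases beval v w A <;> cases beval v w B <;> rfl) ha

theorem and_iff (h : MT X) {A B : Formula} : A.and B ∈ X ↔ (A ∈ X ∧ B ∈ X) := by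
  refine ⟨fun h1 => ⟨h.t1 ?_ h1, h.t1 ?_ h1⟩, fun h1 => h.t2 ?_ h1.1 h1.2⟩ <;>
  · intro v w; simp only [beval]
    cases beval v w A <;> cases beval v w B <;> rfl

theorem or_iff (h : MT X) {A B : Formula} : A.or B ∈ X ↔ (A ∈ X ∨ B ∈ X) := by
  constructor
  · intro h1
    rcases h.total A with ha | ha
    · exact .inl ha
    · refine .inr (h.t2 ?_ h1 ha)
      intro v w; simp only [beval, neg]
      cases beval v w A <;> cases beval v w B <;> rfl
  · rintro (h1 | h1) <;> refine h.t1 ?_ h1 <;>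
    · intro v w; simp only [beval]
      cases beval v w A <;> cases beval v w B <;> rfl

theorem cond_th (h : MT X) (B : Formula) : Th (condCons X B) where
  thm {A} hA := h.mp (h.thm (.rck (.mp (.taut (by
      intro v w; simp only [beval]
      cases beval v w A <;> cases beval v w B <;> rfl)) hA))) (h.thm (.id (A := B)))
  mp {C D} h1 h2 := by
    have h3 : B.cond ((C.imp D).and C) ∈ X := h.mp (h.thm .rAnd) (h.and_iff.2 ⟨h1, h2⟩)
    refine h.mp (h.thm (.rck (.taut ?_))) h3
    intro v w; simp only [beval]
    cases beval v w C <;> cases beval v w D <;> rfl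

theorem self_mem (h : MT X) (B : Formula) : B ∈ condCons X B := h.thm .id

theorem rce (h : MT X) {A B C : Formula} (t : Tautology (A.biimp B)) (ha : A.cond C ∈ X) :
    B.cond C ∈ X :=
  h.mp (h.and_iff.1 (h.thm (.rcea (.taut t)))).1 ha

/-- The rule S. -/
theorem ruleS (h : MT X) {A D K : Formula} (t : Tautology (A.imp K)) (ha : A.cond D ∈ X) :
    (A.imp D) ∈ condCons X K := by
  have h1 : A.cond (A.imp D) ∈ X := (h.cond_th A).t1 (A := D) (by
      intro v w; simp only [beval]
      cases beval v w A <;> cases beval v w D <;> rfl) ha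
  have h2 : (K.and A.neg).cond (A.imp D) ∈ X := (h.cond_th _).t1 (by
      intro v w; simp only [beval, neg]
      cases beval v w A <;> cases beval v w D <;> cases beval v w K <;> rfl) (h.self_mem _)
  have h3 := h.mp (h.thm .or) (h.and_iff.2 ⟨h1, h2⟩)
  refine h.rce ?_ h3
  intro v w
  have := t v w
  revert this
  simp only [beval, neg, biimp]
  cases beval v w A <;> cases beval v w K <;> simp

theorem cmS (h : MT X) {G K F : Formula} (t : Tautology (G.imp K)) (hg : G ∈ condCons X K)
    (hf : F ∈ condCons X K) : F ∈ condCons X G := by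
  refine h.rce ?_ (h.mp (h.thm .cm) (h.and_iff.2 ⟨hg, hf⟩))
  intro v w
  have := t v w
  revert this
  simp only [beval, biimp]
  cases beval v w G <;> cases beval v w K <;> simp

theorem trans_aux (h : MT X) {G E B : Formula} (h1 : cleq X G E) (h2 : cleq X E B) :
    cleq X G B ∧ ((E.or B).imp E) ∈ condCons X G := by
  have s1 : ((G.or E).imp G) ∈ condCons X ((G.or E).or B) := h.ruleS (by
    intro v w; simp only [beval]
    cases beval v w G <;> cases beval v w E <;> cases beval v w B <;> rfl) h1
  have s2 : ((E.or B).imp E) ∈ condCons X ((G.or E).or B) := h.ruleS (by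
    intro v w; simp only [beval]
    cases beval v w G <;> cases beval v w E <;> cases beval v w B <;> rfl) h2
  have s3 : G ∈ condCons X ((G.or E).or B) := (h.cond_th _).t3 (by
    intro v w; simp only [beval]
    cases beval v w G <;> cases beval v w E <;> cases beval v w B <;> rfl) s1 s2 (h.self_mem _)
  have s4 : G.or B ∈ condCons X ((G.or E).or B) := (h.cond_th _).t1 (by
    intro v w; simp only [beval]
    cases beval v w G <;> cases beval v w B <;> rfl) s3
  exact ⟨h.cmS (by
    intro v w; simp only [beval]
    cases beval v w G <;> cases beval v w E <;> cases beval v w B <;> rfl) s4 s3,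
    h.cmS (by
    intro v w; simp only [beval]
    cases beval v w G <;> cases beval v w E <;> cases beval v w B <;> rfl) s3 s2⟩

end MT

/-- Worlds: labelled maximal consistent theories. -/
def World : Type := {p : Set Formula × Formula // MT p.1}

/-- Strict preference relative to a theory. -/
def lt (X : Set Formula) (Z Y : World) : Prop :=
  condCons X Z.val.2 ⊆ Z.val.1 ∧ cleq X Z.val.2 Y.val.2 ∧ Y.val.2 ∉ Z.val.1

theorem lt_trans {X : Set Formula} (hX : MT X) {U Z Y : World} (h1 : lt X U Z) (h2 : lt X Z Y) :
    lt X U Y := by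
  obtain ⟨a, b⟩ := hX.trans_aux h1.2.1 h2.2.1
  refine ⟨h1.1, a, fun hY => h1.2.2 (U.2.mp (h1.1 b) (U.2.or_iff.2 (.inr hY)))⟩

def nb (x Y : World) : Set World := {Z | Z = x ∨ Z = Y ∨ lt x.val.1 Z Y}

theorem nb_mono {x Z Y : World} (h : Z = Y ∨ lt x.val.1 Z Y) : nb x Z ⊆ nb x Y := by
  rcases h with rfl | h
  · exact subset_rfl
  · rintro U (rfl | rfl | hU)
    · exact .inl rfl
    · exact .inr (.inr h)
    · exact .inr (.inr (lt_trans x.2 hU h))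

def pN (x : World) : Set (Set World) :=
  {α | α = {x} ∨ ∃ Y : World, condCons x.val.1 Y.val.2 ⊆ Y.val.1 ∧ α = nb x Y}

def pVal (p : ℕ) : Set World := {w | Formula.atom p ∈ w.val.1}

theorem cond_truth (x : World) (C D : Formula) :
    C.cond D ∈ x.val.1 ↔ ∀ α ∈ pN x, (∃ y ∈ α, C ∈ y.val.1) →
      ∃ β ∈ pN x, β ⊆ α ∧ (∃ y ∈ β, C ∈ y.val.1) ∧
        ∀ y ∈ β, (C ∈ y.val.1 → D ∈ y.val.1) := by
  have hX := x.2
  have xmem : ∀ α ∈ pN x, x ∈ α := by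
    rintro α (rfl | ⟨Y, -, rfl⟩)
    · rfl
    · exact .inl rfl
  by_cases hC : C ∈ x.val.1
  · constructor
    · intro h α hα _
      have hD : D ∈ x.val.1 := hX.mp (hX.mp (hX.thm (.extra (by
        right; left; right; exact ⟨C, D, rfl⟩))) h) hC
      refine ⟨{x}, .inl rfl, by simpa using xmem α hα, ⟨x, rfl, hC⟩, ?_⟩
      rintro y rfl _
      exact hD
    · intro h
      obtain ⟨β, hβ, -, -, h3⟩ := h {x} (.inl rfl) ⟨x, rfl, hC⟩
      exact hX.mp (hX.thm (.extra (by
        right; right; exact ⟨C, D, rfl⟩))) (hX.and_iff.2 ⟨hC, h3 x (xmem β hβ) hC⟩)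
  · constructor
    · rintro h α hα ⟨y, hy, hCy⟩
      by_cases hall : ∀ y ∈ α, (C ∈ y.val.1 → D ∈ y.val.1)
      · exact ⟨α, hα, subset_rfl, ⟨y, hy, hCy⟩, hall⟩
      push Not at hall
      obtain ⟨U, hU, hCU, hDU⟩ := hall
      rcases hα with rfl | ⟨Y, hY, rfl⟩
      · obtain rfl : U = x := hU
        exact absurd hCU hC
      have hUY : U = Y ∨ lt x.val.1 U Y := by
        rcases hU with rfl | hU
        · exact absurd hCU hC
        · exact hU
      have hUn : condCons x.val.1 U.val.2 ⊆ U.val.1 := by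
        rcases hUY with rfl | hU
        · exact hY
        · exact hU.1
      have hS : C.imp D ∈ condCons x.val.1 (C.or U.val.2) := hX.ruleS (by
        intro v w; simp only [beval]
        cases beval v w C <;> cases beval v w U.val.2 <;> rfl) h
      have hG : U.val.2 ∉ condCons x.val.1 (C.or U.val.2) := by
        intro hG
        exact hDU (U.2.mp (hUn (hX.cmS (by
          intro v w; simp only [beval]
          cases beval v w C <;> cases beval v w U.val.2 <;> rfl) hG hS)) hCU)
      obtain ⟨Z, hZ, hsub, hGZ⟩ := lindenbaum (hX.cond_th _) hG
      have hCZ : C ∈ Z := (hZ.or_iff.1 (hsub (hX.self_mem _))).resolve_right hGZ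
      have hlt : lt x.val.1 ⟨(Z, C.or U.val.2), hZ⟩ U := by
        refine ⟨hsub, (hX.cond_th _).t1 (A := (C.or U.val.2).or U.val.2) ?_ (hX.self_mem _), hGZ⟩
        intro v w; simp only [beval]
        cases beval v w C <;> cases beval v w U.val.2 <;> rfl
      refine ⟨nb x ⟨(Z, C.or U.val.2), hZ⟩, .inr ⟨_, hsub, rfl⟩,
        (nb_mono (.inr hlt)).trans (nb_mono hUY), ⟨_, .inr (.inl rfl), hCZ⟩, ?_⟩
      rintro V (rfl | rfl | hV) hCV
      · exact absurd hCV hC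
      · exact hZ.mp (hsub hS) hCZ
      · exact absurd (V.2.or_iff.2 (.inl hCV)) hV.2.2
    · intro h
      by_contra hn
      obtain ⟨Y, hY, hsub, hDY⟩ := lindenbaum (hX.cond_th C) (A := D) hn
      have hCY : C ∈ Y := hsub (hX.self_mem C)
      obtain ⟨β, -, hβα, ⟨y, hy, hCy⟩, h3⟩ := h (nb x ⟨(Y, C), hY⟩) (.inr ⟨_, hsub, rfl⟩)
        ⟨⟨(Y, C), hY⟩, .inr (.inl rfl), hCY⟩
      have hDy := h3 y hy hCy
      rcases hβα hy with rfl | rfl | hlt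
      · exact hC hCy
      · exact hDY hDy
      · exact hlt.2.2 hCy

theorem truth (A : Formula) : ∀ x : World, Force pN pVal A x ↔ A ∈ x.val.1 := by
  induction A with
  | atom p => intro x; rfl
  | bot => intro x; simp only [Force, false_iff]; exact x.2.nbot
  | and A B ihA ihB => intro x; simp only [Force, ihA, ihB, x.2.and_iff]
  | or A B ihA ihB => intro x; simp only [Force, ihA, ihB, x.2.or_iff]
  | imp A B ihA ihB => intro x; simp only [Force, ihA, ihB, x.2.imp_iff]
  | cond A B ihA ihB => intro x; simp only [Force, ihA, ihB]; exact (cond_truth x A B).symm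

end PCProof

/-- Completeness of PC w.r.t. centered neighbourhood models. -/
theorem pc_completeness (F : Formula)
    (h : ∀ M : NbhdModel, M.Centered → ∀ x : M.W, M.force F x) :
    Deriv (insert axN (axT ∪ axW ∪ axC)) F := by
  by_contra hF
  obtain ⟨X, hX, -, hFX⟩ := PCProof.lindenbaum
    (T := {A | Deriv (insert axN (axT ∪ axW ∪ axC)) A}) ⟨fun h => h, fun h1 h2 => .mp h1 h2⟩ hF
  have mem : ∀ x : PCProof.World, ∀ α ∈ PCProof.pN x, x ∈ α := by
    rintro x α (rfl | ⟨Y, -, rfl⟩)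
    · rfl
    · exact .inl rfl
  have := h ⟨PCProof.World, ⟨⟨(X, F), hX⟩⟩, PCProof.pN, PCProof.pVal,
    fun x α hα => ⟨x, mem x α hα⟩⟩ ⟨mem, fun x => .inl rfl⟩ ⟨(X, F), hX⟩
  exact hFX ((PCProof.truth F _).1 this)
end

section
/- Model collapse under centering and absoluteness: in every neighbourhood model satisfying centering and absoluteness, N(x) = {{x}} for every world x; in particular, every neighbourhood of every world is a singleton consisting of that world itself. -/
open Formula

/-- Model collapse under centering and absoluteness. -/
theorem collapse_centered_absolute (M : NbhdModel)
    (hc : M.Centered) (ha : M.Absolute) :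
    ∀ x : M.W, M.N x = {{x}} := by
  intro x
  ext α
  constructor
  · intro hα
    ext y
    constructor
    · intro hy
      have hx : ({x} : Set M.W) ∈ M.N y := ha x y α hα hy ▸ hc.2 x
      exact hc.1 y _ hx
    · rintro rfl
      exact hc.1 _ α hα
  · rintro rfl
    exact hc.2 x
end

section
/- Model collapse under weak centering and absoluteness: in every neighbourhood model satisfying weak centering and absoluteness, for every world x any two neighbourhoods α, β ∈ N(x) are equal; moreover, if α ∈ N(x) and y ∈ α, then N(y) = N(x) = {α}. -/
open Formula

/-- Model collapse under weak centering and absoluteness. -/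
theorem collapse_weakly_centered_absolute (M : NbhdModel)
    (hw : M.WeaklyCentered) (ha : M.Absolute) :
    (∀ x : M.W, ∀ α ∈ M.N x, ∀ β ∈ M.N x, α = β) ∧
      (∀ x : M.W, ∀ α ∈ M.N x, ∀ y ∈ α, M.N y = M.N x ∧ M.N x = {α}) := by
  have sub : ∀ x : M.W, ∀ α ∈ M.N x, ∀ β ∈ M.N x, α ⊆ β := by
    intro x α hα β hβ y hy
    exact hw y β (ha x y α hα hy ▸ hβ)
  have eq : ∀ x : M.W, ∀ α ∈ M.N x, ∀ β ∈ M.N x, α = β := fun x α hα β hβ =>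
    Set.Subset.antisymm (sub x α hα β hβ) (sub x β hβ α hα)
  refine ⟨eq, fun x α hα y hy => ⟨(ha x y α hα hy).symm, ?_⟩⟩
  exact Set.eq_singleton_iff_unique_mem.mpr ⟨hα, fun β hβ => eq x β hβ α hα⟩
end
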